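/- Let Ω be homogeneous of degree zero with ‖Ω‖_{L^∞(S^{d−1})} ≤ 1 and let b ∈ BMO(ℝ^d) with ‖b‖_{BMO} ≤ 1. Then for every r ∈ (1,∞), every integer s ≥ 100, every j ∈ ℤ, ν ∈ Λ_s and every x ∈ ℝ^d, ‖Σ_{i≤j} Σ_{I∈S_{i−s}, I∩(x+R_{jν}^s)≠∅} |b − ⟨b⟩_I|·|T_{iν}^s h_I| ‖_{L¹(ℝ^d)} ≤ C_{d,γ,r} 2^{−2γs(d−1)/r} 2^{jd}. -/

import Mathlib

open MeasureTheory Metric Set Filter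
open scoped ENNReal NNReal Real Topology Pointwise FourierTransform RealInnerProductSpace

noncomputable section

/-- Euclidean space `ℝ^d`. -/
abbrev Rd (d : ℕ) := EuclideanSpace ℝ (Fin d)

/-- Surface measure on the unit sphere `S^{d-1}`, realized as the `(d-1)`-dimensional
Hausdorff measure restricted to the sphere. -/
def sphereMeasure (d : ℕ) : Measure (Rd d) := (μH[(d : ℝ) - 1]).restrict (sphere (0 : Rd d) 1)

/-- `Φ(t) = t log(e + t)`. -/
def Phi (t : ℝ) : ℝ := t * Real.log (Real.exp 1 + t)

/-- `Q` is an (axis-parallel, closed) cube with side length `l`. -/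
def IsCubeSide {d : ℕ} (Q : Set (Rd d)) (l : ℝ) : Prop :=
  ∃ c : Rd d, Q = {x | ∀ i, x i ∈ Icc (c i) (c i + l)}

/-- `Q` is a (nondegenerate) cube. -/
def IsCube {d : ℕ} (Q : Set (Rd d)) : Prop := ∃ l : ℝ, 0 < l ∧ IsCubeSide Q l

/-- `Q` is a standard dyadic cube `2^k([0,1]^d + m)`. -/
def IsDyadicCube {d : ℕ} (Q : Set (Rd d)) : Prop :=
  ∃ (k : ℤ) (m : Fin d → ℤ),
    Q = {x | ∀ i, x i ∈ Icc ((2:ℝ)^k * m i) ((2:ℝ)^k * (m i + 1))}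

/-- mean value `⟨b⟩_Q` of `b` on `Q`. -/
def cavg {d : ℕ} (b : Rd d → ℝ) (Q : Set (Rd d)) : ℝ := ⨍ x in Q, b x

/-- `b` is in `BMO(ℝ^d)` with `‖b‖_{BMO} ≤ M`. -/
def BMOBound {d : ℕ} (b : Rd d → ℝ) (M : ℝ) : Prop :=
  MeasureTheory.LocallyIntegrable b volume ∧
    ∀ Q : Set (Rd d), IsCube Q → (⨍ x in Q, |b x - cavg b Q|) ≤ M

/-- `Ω` is homogeneous of degree zero. -/
def Homog0 {d : ℕ} (Ω : Rd d → ℝ) : Prop := ∀ r : ℝ, 0 < r → ∀ x : Rd d, Ω (r • x) = Ω x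

/-- The Luxemburg norm `‖f‖_{L^p(log L)^α, Q}`
(`∞`, i.e. `⊤`, if no admissible constant exists). -/
def LuxNorm {d : ℕ} (p α : ℝ) (Q : Set (Rd d)) (f : Rd d → ℝ) : ℝ≥0∞ :=
  sInf {c : ℝ≥0∞ | ∃ t : ℝ, 0 < t ∧ c = ENNReal.ofReal t ∧
    ∫⁻ x in Q,
      ENNReal.ofReal ((|f x| / t) ^ p * (Real.log (Real.exp 1 + |f x| / t)) ^ α) ≤ volume Q}

/-- convolution `K * g`. -/
def convK {d : ℕ} (K g : Rd d → ℝ) (x : Rd d) : ℝ := ∫ y, K (x - y) * g y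

/-- Truncated kernel `K_j(x) = Ω(x/|x|)|x|^{-d} φ_j(x)`, where `φ_j(x) = φ(2^{-j}x)`. -/
def Kj {d : ℕ} (Ωi φ : Rd d → ℝ) (j : ℤ) (x : Rd d) : ℝ :=
  Ωi (‖x‖⁻¹ • x) / ‖x‖ ^ d * φ ((2:ℝ) ^ (-j) • x)

/-- Hypotheses on the radial cut-off function `φ`: smooth, nonnegative, radial,
supported in `{1/2 ≤ |x| ≤ 2}`, with `Σ_j φ(2^{-j}x) = 1` for `x ≠ 0`. -/
def PhiCutoff {d : ℕ} (φ : Rd d → ℝ) : Prop :=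
  ContDiff ℝ (⊤ : ℕ∞) φ ∧ (∀ x, 0 ≤ φ x) ∧ (∃ g : ℝ → ℝ, ∀ x, φ x = g ‖x‖) ∧
    Function.support φ ⊆ {x : Rd d | 1/2 ≤ ‖x‖ ∧ ‖x‖ ≤ 2} ∧
    ∀ x : Rd d, x ≠ 0 → HasSum (fun j : ℤ => φ ((2:ℝ) ^ (-j) • x)) 1

/-- The angular cut-offs `Γ_ν^s` built from `ζ` and the net `{e_ν}`; here `a = sγ`. -/
def Gam {d : ℕ} {ι : Type} [Fintype ι] (ζ : Rd d → ℝ) (e : ι → Rd d) (a : ℝ)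
    (ν : ι) (ξ : Rd d) : ℝ :=
  ζ ((2:ℝ) ^ a • (‖ξ‖⁻¹ • ξ - e ν)) / ∑ ν' : ι, ζ ((2:ℝ) ^ a • (‖ξ‖⁻¹ • ξ - e ν'))

/-- Symbol of the multiplier operator `G_ν^s`: `ψ(2^{sγ}⟨ξ/|ξ|, e_ν⟩)`; here `a = sγ`. -/
def GSymb {d : ℕ} (ψ : ℝ → ℝ) (a : ℝ) (e : Rd d) (ξ : Rd d) : ℝ :=
  ψ ((2:ℝ) ^ a * ⟪‖ξ‖⁻¹ • ξ, e⟫)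

/-- Kernel `K_{jν}^s(x) = Ω(x/|x|)|x|^{-d} φ_j(x) Γ_ν^s(x/|x|)`; here `a = sγ`. -/
def Kjnu {d : ℕ} {ι : Type} [Fintype ι] (Ω φ ζ : Rd d → ℝ) (e : ι → Rd d) (a : ℝ)
    (j : ℤ) (ν : ι) (x : Rd d) : ℝ :=
  Ω (‖x‖⁻¹ • x) / ‖x‖ ^ d * φ ((2:ℝ) ^ (-j) • x) * Gam ζ e a ν (‖x‖⁻¹ • x)

/-- Hypotheses on `ζ`: smooth, nonnegative, radial, supported in `B(0,1)`, `≡1` on `B(0,1/2)`. -/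
def ZetaCutoff {d : ℕ} (ζ : Rd d → ℝ) : Prop :=
  ContDiff ℝ (⊤ : ℕ∞) ζ ∧ (∀ x, 0 ≤ ζ x) ∧ (∃ g : ℝ → ℝ, ∀ x, ζ x = g ‖x‖) ∧
    Function.support ζ ⊆ ball (0 : Rd d) 1 ∧ ∀ x ∈ ball (0 : Rd d) (1/2), ζ x = 1

/-- Hypotheses on `ψ`: smooth, `0 ≤ ψ ≤ 1`, supported in `[-4,4]`, `≡1` on `[-2,2]`. -/
def PsiCutoff (ψ : ℝ → ℝ) : Prop :=
  ContDiff ℝ (⊤ : ℕ∞) ψ ∧ (∀ t, 0 ≤ ψ t ∧ ψ t ≤ 1) ∧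
    Function.support ψ ⊆ Icc (-4:ℝ) 4 ∧ ∀ t ∈ Icc (-2:ℝ) 2, ψ t = 1

/-- `{e_ν}_{ν∈Λ_s}` is a `2^{-sγ-4}`-separated net of unit vectors covering the sphere. -/
def SphereNet {d : ℕ} {ι : Type} (e : ι → Rd d) (s : ℕ) (γ : ℝ) : Prop :=
  (∀ ν, ‖e ν‖ = 1) ∧
    (∀ ν ν', ν ≠ ν' → (2:ℝ) ^ (-(s:ℝ) * γ - 4) < ‖e ν - e ν'‖) ∧
    ∀ θ : Rd d, ‖θ‖ = 1 → ∃ ν, ‖θ - e ν‖ ≤ (2:ℝ) ^ (-(s:ℝ) * γ - 4)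

/-- `G ν` is the Fourier multiplier operator with symbol `ψ(2^{sγ}⟨ξ/|ξ|, e_ν⟩)`;
here `a = sγ`. -/
def IsGNu {d : ℕ} {ι : Type} (G : ι → (Rd d → ℂ) → (Rd d → ℂ)) (ψ : ℝ → ℝ) (a : ℝ)
    (e : ι → Rd d) : Prop :=
  ∀ (ν : ι) (g : Rd d → ℂ), Integrable g volume →
    ∀ ξ, 𝓕 (G ν g) ξ = (GSymb ψ a (e ν) ξ : ℂ) * 𝓕 g ξ

/-- `S` is a collection of dyadic cubes with pairwise disjoint interiors and, for every
`Q ∈ S`, `h Q` is integrable, supported in `Q`, with `‖h Q‖_{L¹} ≤ |Q|`. -/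
def GoodFamily {d : ℕ} (S : Set (Set (Rd d))) (h : Set (Rd d) → Rd d → ℝ) : Prop :=
  (∀ Q ∈ S, IsDyadicCube Q) ∧
    (S.Pairwise fun Q Q' => interior Q ∩ interior Q' = ∅) ∧
    ∀ Q ∈ S, Integrable (h Q) volume ∧ Function.support (h Q) ⊆ Q ∧
      (∫⁻ x, ENNReal.ofReal |h Q x|) ≤ volume Q

/-- The tube `R̃_{jν}^s` around `e_ν`; here `a = sγ`. -/
def Rtil {d : ℕ} (eν : Rd d) (j : ℤ) (a : ℝ) : Set (Rd d) :=
  {y | |⟪y, eν⟫| ≤ (2:ℝ) ^ (j + 2) ∧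
    ‖y - ⟪y, eν⟫ • eν‖ ≤ (2:ℝ) ^ (j + 2) * (2:ℝ) ^ (-a)}

/-- `R_{jν}^s = R̃_{jν}^s + R̃_{jν}^s`. -/
def RR {d : ℕ} (eν : Rd d) (j : ℤ) (a : ℝ) : Set (Rd d) := Rtil eν j a + Rtil eν j a

/-- The solid tube with axis `e`, half-length `A` and radius `B`. -/
def tube {d : ℕ} (e : Rd d) (A B : ℝ) : Set (Rd d) :=
  {y | |⟪y, e⟫| ≤ A ∧ ‖y - ⟪y, e⟫ • e‖ ≤ B}

/-- The closed cube with lower corner `c` and side length `l`. -/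
def cube {d : ℕ} (c : Rd d) (l : ℝ) : Set (Rd d) :=
  {x | ∀ i, x i ∈ Icc (c i) (c i + l)}

section Tubes

variable {d : ℕ}

lemma isClosed_tube (e : Rd d) (A B : ℝ) : IsClosed (tube e A B) := by
  have h1 : Continuous fun y : Rd d => |⟪y, e⟫| := by fun_prop
  have h2 : Continuous fun y : Rd d => ‖y - ⟪y, e⟫ • e‖ := by fun_prop
  exact (isClosed_le h1 continuous_const).inter (isClosed_le h2 continuous_const)

lemma norm_sub_inner_smul_le {e : Rd d} (he : ‖e‖ = 1) (y : Rd d) (t : ℝ) :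
    ‖y - ⟪y, e⟫ • e‖ ≤ ‖y - t • e‖ := by
  refine (sq_le_sq₀ (norm_nonneg _) (norm_nonneg _)).mp ?_
  rw [norm_sub_sq_real, norm_sub_sq_real]
  simp only [norm_smul, inner_smul_right, he, mul_one, Real.norm_eq_abs, sq_abs]
  nlinarith [sq_nonneg (⟪y, e⟫ - t)]

lemma mem_tube_of_norm_le {e : Rd d} (he : ‖e‖ = 1) {w : Rd d} {ρ : ℝ} (hw : ‖w‖ ≤ ρ) :
    w ∈ tube e ρ ρ := by
  refine ⟨?_, ?_⟩
  · have := abs_real_inner_le_norm w e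
    rw [he, mul_one] at this
    exact this.trans hw
  · have := norm_sub_inner_smul_le he w 0
    rw [zero_smul, sub_zero] at this
    exact this.trans hw

lemma add_mem_tube {e : Rd d} {y w : Rd d} {A B A' B' : ℝ} (hy : y ∈ tube e A B)
    (hw : w ∈ tube e A' B') : y + w ∈ tube e (A + A') (B + B') := by
  refine ⟨?_, ?_⟩
  · rw [inner_add_left]
    exact (abs_add_le _ _).trans (add_le_add hy.1 hw.1)
  · have : y + w - ⟪y + w, e⟫ • e = (y - ⟪y, e⟫ • e) + (w - ⟪w, e⟫ • e) := by
      rw [inner_add_left, add_smul]; abel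
    rw [this]
    exact (norm_add_le _ _).trans (add_le_add hy.2 hw.2)

lemma tube_mono {e : Rd d} {A B A' B' : ℝ} (hA : A ≤ A') (hB : B ≤ B') :
    tube e A B ⊆ tube e A' B' := fun _ hy => ⟨hy.1.trans hA, hy.2.trans hB⟩

lemma norm_le_of_mem_tube {e : Rd d} (he : ‖e‖ = 1) {y : Rd d} {A B : ℝ}
    (hy : y ∈ tube e A B) : ‖y‖ ≤ A + B := by
  have h : y = ⟪y, e⟫ • e + (y - ⟪y, e⟫ • e) := by abel
  calc ‖y‖ = ‖⟪y, e⟫ • e + (y - ⟪y, e⟫ • e)‖ := by rw [← h]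
    _ ≤ ‖⟪y, e⟫ • e‖ + ‖y - ⟪y, e⟫ • e‖ := norm_add_le _ _
    _ ≤ A + B := by
      rw [norm_smul, he, mul_one]
      exact add_le_add hy.1 hy.2

lemma volume_tube_le (hd : 1 ≤ d) {e : Rd d} (he : ‖e‖ = 1) (A B : ℝ) :
    volume (tube e A B) ≤ ENNReal.ofReal (2 * A) * ENNReal.ofReal (2 * B) ^ (d - 1) := by
  obtain ⟨n, rfl⟩ : ∃ n, d = n + 1 := ⟨d - 1, by omega⟩
  obtain ⟨b, hb⟩ := Orthonormal.exists_orthonormalBasis_extension_of_card_eq (𝕜 := ℝ)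
    (E := Rd (n + 1)) (ι := Fin (n + 1)) (by simp) (v := fun _ => e) (s := {0}) (by
      constructor
      · intro i; simpa using he
      · intro i j hij
        exact absurd (Subsingleton.elim i j) hij)
  have hb0 : b 0 = e := hb 0 rfl
  set c : Fin (n + 1) → ℝ := Fin.cons A (fun _ => B) with hc
  have hsub : tube e A B ⊆
      (fun y => (b.repr y).ofLp) ⁻¹' (Icc (fun i => -c i) c) := by
    intro y hy
    have key : ∀ i, |(b.repr y) i| ≤ c i := by
      intro i
      rw [OrthonormalBasis.repr_apply_apply]
      refine Fin.cases ?_ (fun k => ?_) i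
      · rw [hb0, real_inner_comm]
        simpa [hc] using hy.1
      · have h0 : ⟪b k.succ, e⟫ = 0 := by
          rw [← hb0]
          exact b.orthonormal.2 (Fin.succ_ne_zero k)
        have h1 : ⟪b k.succ, y⟫ = ⟪b k.succ, y - ⟪y, e⟫ • e⟫ := by
          rw [inner_sub_right, inner_smul_right, h0, mul_zero, sub_zero]
        rw [h1]
        have := abs_real_inner_le_norm (b k.succ) (y - ⟪y, e⟫ • e)
        rw [b.orthonormal.1, one_mul] at this
        simpa [hc] using this.trans hy.2
    exact ⟨fun i => (abs_le.mp (key i)).1, fun i => (abs_le.mp (key i)).2⟩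
  have hmp : MeasurePreserving (fun y : Rd (n + 1) => (b.repr y).ofLp) volume volume :=
    (PiLp.volume_preserving_ofLp (Fin (n + 1))).comp b.repr.measurePreserving
  refine (measure_mono hsub).trans ?_
  rw [hmp.measure_preimage measurableSet_Icc.nullMeasurableSet, Real.volume_Icc_pi,
    Fin.prod_univ_succ]
  simp [hc, two_mul]

lemma volume_tube_scaled_le (hd : 1 ≤ d) {e : Rd d} (he : ‖e‖ = 1) {κ L ρ : ℝ} (hκ : 0 ≤ κ)
    (hL : 0 ≤ L) (hρ : 0 ≤ ρ) :
    volume (tube e (κ * L) (κ * L * ρ)) ≤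
      ENNReal.ofReal ((2 * κ) ^ d * (L ^ d * ρ ^ (d - 1))) := by
  refine (volume_tube_le hd he _ _).trans (le_of_eq ?_)
  obtain ⟨n, rfl⟩ : ∃ n, d = n + 1 := ⟨d - 1, by omega⟩
  rw [← ENNReal.ofReal_pow (by positivity), ← ENNReal.ofReal_mul (by positivity)]
  congr 1
  simp only [Nat.add_sub_cancel]
  ring

lemma norm_le_of_forall_abs_le {w : Rd d} {l : ℝ} (h : ∀ i, |w i| ≤ l) :
    ‖w‖ ≤ d * l := by
  rcases Nat.eq_zero_or_pos d with rfl | hd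
  · simp [EuclideanSpace.norm_eq]
  have hl : 0 ≤ l := (abs_nonneg _).trans (h ⟨0, hd⟩)
  rw [EuclideanSpace.norm_eq]
  refine Real.sqrt_le_iff.mpr ⟨by positivity, ?_⟩
  calc ∑ i, ‖w i‖ ^ 2 ≤ ∑ _i : Fin d, l ^ 2 :=
        Finset.sum_le_sum fun i _ => pow_le_pow_left₀ (norm_nonneg _) (h i) 2
    _ = d * l ^ 2 := by simp
    _ ≤ (d * l) ^ 2 := by
      have : (1 : ℝ) ≤ d := by exact_mod_cast hd
      nlinarith [sq_nonneg l, mul_nonneg (sub_nonneg.2 this) (sq_nonneg l)]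

lemma norm_sub_le_of_mem_cube {c p q : Rd d} {l : ℝ} (hp : p ∈ cube c l) (hq : q ∈ cube c l) :
    ‖p - q‖ ≤ d * l := by
  refine norm_le_of_forall_abs_le fun i => ?_
  have h1 := hp i
  have h2 := hq i
  simp only [mem_Icc] at h1 h2
  rw [PiLp.sub_apply, abs_le]
  constructor <;> linarith

lemma corner_mem_cube (c : Rd d) {l : ℝ} (hl : 0 ≤ l) : c ∈ cube c l := fun i => by
  simp [hl]

lemma cube_eq_preimage (c : Rd d) (l : ℝ) :
    cube c l = WithLp.ofLp ⁻¹' Icc (c.ofLp) (fun i => c i + l) := by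
  ext x
  simp only [cube, mem_ofPred_eq, mem_preimage, mem_Icc, Pi.le_def]
  exact ⟨fun h => ⟨fun i => (h i).1, fun i => (h i).2⟩, fun h i => ⟨h.1 i, h.2 i⟩⟩

lemma isClosed_cube (c : Rd d) (l : ℝ) : IsClosed (cube c l) := by
  rw [cube_eq_preimage]
  exact isClosed_Icc.preimage (PiLp.continuous_ofLp 2 _)

lemma isCompact_cube (c : Rd d) (l : ℝ) : IsCompact (cube c l) := by
  refine Metric.isCompact_of_isClosed_isBounded (isClosed_cube c l) ?_
  refine Metric.isBounded_iff.mpr ⟨d * l, fun p hp q hq => ?_⟩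
  rw [dist_eq_norm]
  exact norm_sub_le_of_mem_cube hp hq

lemma volume_cube (c : Rd d) (l : ℝ) : volume (cube c l) = ENNReal.ofReal l ^ d := by
  rw [cube_eq_preimage, (PiLp.volume_preserving_ofLp (Fin d)).measure_preimage
    measurableSet_Icc.nullMeasurableSet, Real.volume_Icc_pi]
  simp

lemma volume_interior_cube (c : Rd d) (l : ℝ) :
    volume (interior (cube c l)) = ENNReal.ofReal l ^ d := by
  refine le_antisymm ((measure_mono interior_subset).trans (volume_cube c l).le) ?_
  have hsub : WithLp.ofLp ⁻¹' (univ.pi fun i => Ioo (c i) (c i + l)) ⊆ interior (cube c l) := by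
    refine interior_maximal ?_ ?_
    · intro x hx i
      exact Ioo_subset_Icc_self (hx i (mem_univ i))
    · exact (isOpen_set_pi finite_univ fun i _ => isOpen_Ioo).preimage
        (PiLp.continuous_ofLp 2 _)
  refine le_trans (le_of_eq ?_) (measure_mono hsub)
  rw [(PiLp.volume_preserving_ofLp (Fin d)).measure_preimage
    (MeasurableSet.univ_pi fun i => measurableSet_Ioo).nullMeasurableSet, Real.volume_pi_Ioo]
  simp

end Tubes

section Polar

variable {d : ℕ}

/-- The radial projection of `volume` on a ball is dominated by a multiple of the
`(d-1)`-dimensional Hausdorff measure. -/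
lemma map_normalize_restrict_ball_absolutelyContinuous (hd : 2 ≤ d) {R : ℝ} (hR : 0 < R) :
    ((volume.restrict (ball (0 : Rd d) R)).map fun x => ‖x‖⁻¹ • x) ≪ μH[(d : ℝ) - 1] := by
  have hmeas : Measurable fun x : Rd d => ‖x‖⁻¹ • x := by fun_prop
  set ν := (volume.restrict (ball (0 : Rd d) R)).map fun x => ‖x‖⁻¹ • x with hν
  set K : ℝ≥0∞ := ENNReal.ofReal (2 * R) * ENNReal.ofReal (2 * R) ^ (d - 1) with hK
  have hpos : 0 < ENNReal.ofReal (2 * R) := ENNReal.ofReal_pos.mpr (by positivity)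
  have hK0 : K ≠ 0 := mul_ne_zero hpos.ne' (pow_ne_zero _ hpos.ne')
  have hKt : K ≠ ⊤ := ENNReal.mul_ne_top ENNReal.ofReal_ne_top
    (ENNReal.pow_ne_top ENNReal.ofReal_ne_top)
  have hle : K⁻¹ • ν ≤ μH[(d : ℝ) - 1] := by
    refine Measure.le_hausdorffMeasure _ _ 1 one_pos fun s hs => ?_
    have hfin : ediam s ≠ ⊤ := ne_top_of_le_ne_top ENNReal.one_ne_top hs
    have hcast : ((d : ℝ) - 1) = ((d - 1 : ℕ) : ℝ) := by
      rw [Nat.cast_sub (by omega)]; simp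
    rw [Measure.smul_apply, smul_eq_mul, hcast, ENNReal.rpow_natCast,
      ENNReal.inv_mul_le_iff hK0 hKt]
    refine (measure_mono subset_closure).trans ?_
    rw [hν, Measure.map_apply hmeas isClosed_closure.measurableSet,
      Measure.restrict_apply (hmeas isClosed_closure.measurableSet)]
    by_cases hex : ∃ x₀ : Rd d, x₀ ≠ 0 ∧ ‖x₀‖⁻¹ • x₀ ∈ closure s
    · obtain ⟨x₀, hx₀, hmem⟩ := hex
      have hθ : ‖‖x₀‖⁻¹ • x₀‖ = 1 := norm_smul_inv_norm (𝕜 := ℝ) hx₀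
      set θ := ‖x₀‖⁻¹ • x₀
      have hsub : (fun x : Rd d => ‖x‖⁻¹ • x) ⁻¹' closure s ∩ ball 0 R ⊆
          tube θ R (R * (ediam s).toReal) := by
        rintro x ⟨hx, hxR⟩
        rw [mem_ball_zero_iff] at hxR
        refine ⟨?_, ?_⟩
        · have := abs_real_inner_le_norm x θ
          rw [hθ, mul_one] at this
          exact this.trans hxR.le
        · refine (norm_sub_inner_smul_le hθ x ‖x‖).trans ?_
          by_cases hx0 : x = 0
          · simp only [hx0, norm_zero, zero_smul, sub_zero]
            positivity
          have hxe : x - ‖x‖ • θ = ‖x‖ • (‖x‖⁻¹ • x - θ) := by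
            rw [smul_sub, smul_inv_smul₀ (norm_ne_zero_iff.mpr hx0)]
          rw [hxe, norm_smul, norm_norm]
          refine mul_le_mul hxR.le ?_ (norm_nonneg _) hR.le
          rw [← dist_eq_norm, ← Metric.ediam_closure, dist_edist]
          refine ENNReal.toReal_mono (by rwa [Metric.ediam_closure]) ?_
          exact Metric.edist_le_ediam_of_mem hx hmem
      refine (measure_mono hsub).trans ((volume_tube_le (by omega) hθ _ _).trans (le_of_eq ?_))
      rw [hK, ← mul_assoc 2 R, ENNReal.ofReal_mul (p := 2 * R) (by positivity),
        ENNReal.ofReal_toReal hfin, mul_pow, mul_assoc]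
    · have hsub : (fun x : Rd d => ‖x‖⁻¹ • x) ⁻¹' closure s ∩ ball 0 R ⊆ {0} := by
        rintro x ⟨hx, -⟩
        by_contra h0
        exact hex ⟨x, h0, hx⟩
      have : Nontrivial (Rd d) := by
        have : Nonempty (Fin d) := ⟨⟨0, by omega⟩⟩
        infer_instance
      have h0 : volume ({0} : Set (Rd d)) = 0 := measure_singleton 0
      rw [measure_mono_null hsub h0]
      exact zero_le
  intro N hN
  have h1 := hle N
  rw [hN, Measure.smul_apply, smul_eq_mul, nonpos_iff_eq_zero, mul_eq_zero] at h1
  exact h1.resolve_left (ENNReal.inv_ne_zero.mpr hKt)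

lemma ae_normalize_of_ae_sphereMeasure (hd : 2 ≤ d) {P : Rd d → Prop}
    (h : ∀ᵐ θ ∂(sphereMeasure d), P θ) :
    ∀ᵐ x ∂(volume : Measure (Rd d)), x ≠ 0 → P (‖x‖⁻¹ • x) := by
  rw [sphereMeasure, ae_restrict_iff' isClosed_sphere.measurableSet] at h
  have hball : ∀ n : ℕ, ∀ᵐ x ∂(volume.restrict (ball (0 : Rd d) n)),
      x ≠ 0 → P (‖x‖⁻¹ • x) := by
    intro n
    rcases Nat.eq_zero_or_pos n with rfl | hn
    · simp
    have h1 := (map_normalize_restrict_ball_absolutelyContinuous hd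
      (R := (n : ℝ)) (by exact_mod_cast hn)).ae_le h
    have h2 := ae_of_ae_map (by fun_prop) h1
    filter_upwards [h2] with x hx hx0
    exact hx (by simpa using norm_smul_inv_norm (𝕜 := ℝ) hx0)
  have := (ae_restrict_iUnion_iff (fun n : ℕ => ball (0 : Rd d) n) _).mpr hball
  rwa [Metric.iUnion_ball_nat, Measure.restrict_univ] at this

end Polar

section MeanOscillation

variable {d : ℕ}

lemma isCube_cube (c : Rd d) {l : ℝ} (hl : 0 < l) : IsCube (cube c l) := ⟨l, hl, c, rfl⟩

lemma volume_real_cube (c : Rd d) {l : ℝ} (hl : 0 ≤ l) : volume.real (cube c l) = l ^ d := by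
  rw [measureReal_def, volume_cube, ENNReal.toReal_pow, ENNReal.toReal_ofReal hl]

lemma integrableOn_cube {b : Rd d → ℝ} (hb : LocallyIntegrable b volume) (c : Rd d) (l : ℝ) :
    IntegrableOn b (cube c l) volume :=
  hb.integrableOn_isCompact (isCompact_cube c l)

lemma integrableOn_cube_abs_sub {b : Rd d → ℝ} (hb : LocallyIntegrable b volume)
    (c : Rd d) (l k : ℝ) : IntegrableOn (fun x => |b x - k|) (cube c l) volume := by
  refine Integrable.abs ((integrableOn_cube hb c l).sub ?_)
  exact integrableOn_const (isCompact_cube c l).measure_lt_top.ne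

lemma abs_cavg_sub_le {b : Rd d → ℝ} (hb : LocallyIntegrable b volume) (c : Rd d) {l : ℝ}
    (hl : 0 < l) (k : ℝ) :
    |cavg b (cube c l) - k| ≤ (l ^ d)⁻¹ * ∫ x in cube c l, |b x - k| := by
  have hpos : 0 < l ^ d := by positivity
  have h1 : cavg b (cube c l) - k = (l ^ d)⁻¹ * ∫ x in cube c l, (b x - k) := by
    rw [cavg, setAverage_eq, volume_real_cube c hl.le, smul_eq_mul,
      integral_sub (integrableOn_cube hb c l)
        (integrableOn_const (isCompact_cube c l).measure_lt_top.ne),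
      setIntegral_const, volume_real_cube c hl.le, smul_eq_mul]
    field_simp
  rw [h1, abs_mul, abs_of_pos (inv_pos.mpr hpos)]
  exact mul_le_mul_of_nonneg_left abs_integral_le_integral_abs (inv_pos.mpr hpos).le

lemma BMOBound.integral_abs_sub_le {b : Rd d → ℝ} {M : ℝ} (hb : BMOBound b M) (c : Rd d) {l : ℝ}
    (hl : 0 < l) : ∫ x in cube c l, |b x - cavg b (cube c l)| ≤ M * l ^ d := by
  have h := hb.2 _ (isCube_cube c hl)
  rw [setAverage_eq, volume_real_cube c hl.le, smul_eq_mul, inv_mul_le_iff₀ (by positivity)] at h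
  linarith

lemma BMOBound.abs_cavg_sub_cavg_le {b : Rd d → ℝ} (hb : BMOBound b 1) {c c' : Rd d} {l : ℝ}
    (hl : 0 < l) (hsub : cube c l ⊆ cube c' (2 * l)) :
    |cavg b (cube c l) - cavg b (cube c' (2 * l))| ≤ 2 ^ d := by
  refine (abs_cavg_sub_le hb.1 c hl _).trans ?_
  rw [inv_mul_le_iff₀ (by positivity)]
  calc ∫ x in cube c l, |b x - cavg b (cube c' (2 * l))|
      ≤ ∫ x in cube c' (2 * l), |b x - cavg b (cube c' (2 * l))| :=
        setIntegral_mono_set (integrableOn_cube_abs_sub hb.1 _ _ _)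
          (Eventually.of_forall fun _ => abs_nonneg _) hsub.eventuallyLE
    _ ≤ 1 * (2 * l) ^ d := hb.integral_abs_sub_le c' (by positivity)
    _ = l ^ d * 2 ^ d := by rw [mul_pow]; ring

lemma BMOBound.abs_cavg_sub_cavg_dilate_le {b : Rd d → ℝ} (hb : BMOBound b 1) (c : Rd d) {l : ℝ}
    (hl : 0 < l) (k : ℕ) :
    |cavg b (cube c l) - cavg b (cube c (2 ^ k * l))| ≤ k * 2 ^ d := by
  induction k with
  | zero => simp
  | succ k ih =>
    have hpos : 0 < 2 ^ k * l := by positivity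
    have h1 := hb.abs_cavg_sub_cavg_le (c := c) (c' := c) hpos (fun x hx i =>
      ⟨(hx i).1, (hx i).2.trans (by linarith)⟩)
    have h2 : (2 : ℝ) ^ (k + 1) * l = 2 * (2 ^ k * l) := by ring
    rw [h2]
    refine (abs_sub_le _ _ _).trans ((add_le_add ih h1).trans (le_of_eq ?_))
    push_cast
    ring

lemma BMOBound.abs_cavg_sub_cavg_translate_le {b : Rd d → ℝ} (hb : BMOBound b 1)
    {c c' : Rd d} {l : ℝ} (hl : 0 < l) (k : ℕ) (hcc : ∀ i, |c i - c' i| ≤ 2 ^ k * l) :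
    |cavg b (cube c l) - cavg b (cube c' l)| ≤ (2 * k + 2) * 2 ^ d := by
  have hpos : 0 < 2 ^ k * l := by positivity
  set m : Rd d := WithLp.toLp 2 fun i => min (c i) (c' i) with hm
  have hmi : ∀ i, m i = min (c i) (c' i) := fun i => rfl
  have h1 := hb.abs_cavg_sub_cavg_dilate_le c hl k
  have h2 := hb.abs_cavg_sub_cavg_dilate_le c' hl k
  have h3 := hb.abs_cavg_sub_cavg_le (c := c) (c' := m) hpos (fun x hx i => by
    have hx' := hx i
    have := abs_le.mp (hcc i)
    rw [mem_Icc] at hx' ⊢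
    rw [hmi]
    refine ⟨(min_le_left _ _).trans hx'.1, ?_⟩
    rcases min_choice (c i) (c' i) with h | h <;> rw [h] <;> linarith)
  have h4 := hb.abs_cavg_sub_cavg_le (c := c') (c' := m) hpos (fun x hx i => by
    have hx' := hx i
    have := abs_le.mp (hcc i)
    rw [mem_Icc] at hx' ⊢
    rw [hmi]
    refine ⟨(min_le_right _ _).trans hx'.1, ?_⟩
    rcases min_choice (c i) (c' i) with h | h <;> rw [h] <;> linarith)
  rw [abs_le] at *
  constructor <;> nlinarith

lemma BMOBound.lintegral_abs_sub_cavg_le {b : Rd d → ℝ} (hb : BMOBound b 1)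
    {c c' : Rd d} {l : ℝ} (hl : 0 < l) (k : ℕ) (hcc : ∀ i, |c i - c' i| ≤ 2 ^ k * l) :
    ∫⁻ x in cube c l, ENNReal.ofReal |b x - cavg b (cube c' l)| ≤
      ENNReal.ofReal (1 + (2 * k + 2) * 2 ^ d) * ENNReal.ofReal l ^ d := by
  rw [← ofReal_integral_eq_lintegral_ofReal (integrableOn_cube_abs_sub hb.1 _ _ _)
    (Eventually.of_forall fun _ => abs_nonneg _), ← ENNReal.ofReal_pow hl.le,
    ← ENNReal.ofReal_mul (by positivity)]
  refine ENNReal.ofReal_le_ofReal ?_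
  set K := cavg b (cube c' l)
  set A := cavg b (cube c l) with hA
  calc ∫ x in cube c l, |b x - K| ≤ ∫ x in cube c l, (|b x - A| + |A - K|) := by
        refine setIntegral_mono (integrableOn_cube_abs_sub hb.1 _ _ _)
          ((integrableOn_cube_abs_sub hb.1 _ _ _).add
            (integrableOn_const (isCompact_cube c l).measure_lt_top.ne)) fun x => ?_
        exact abs_sub_le _ _ _
    _ = (∫ x in cube c l, |b x - A|) + l ^ d * |A - K| := by
        rw [integral_add (integrableOn_cube_abs_sub hb.1 _ _ _)
          (integrableOn_const (isCompact_cube c l).measure_lt_top.ne), setIntegral_const,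
          volume_real_cube c hl.le, smul_eq_mul]
    _ ≤ 1 * l ^ d + l ^ d * ((2 * k + 2) * 2 ^ d) :=
        add_le_add (hb.integral_abs_sub_le c hl) (mul_le_mul_of_nonneg_left
          (hb.abs_cavg_sub_cavg_translate_le hl k hcc) (by positivity))
    _ = (1 + (2 * k + 2) * 2 ^ d) * l ^ d := by ring

/-- If every cube of side `l` with corner in `E'` carries mass at most `M l^d` of `f`, and `E'`
contains the corners of all such cubes meeting `E`, then `E` carries mass at most `M |E'|`. -/
lemma setLIntegral_le_mul_volume_of_cube {f : Rd d → ℝ≥0∞} (hf : AEMeasurable f volume)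
    {E E' : Set (Rd d)} (hE : MeasurableSet E) (hE' : MeasurableSet E') {l : ℝ} (hl : 0 < l)
    {M : ℝ≥0∞} (hM : ∀ u ∈ E', ∫⁻ x in cube u l, f x ≤ M * ENNReal.ofReal l ^ d)
    (hEE' : ∀ u, ∀ z ∈ E, z ∈ cube u l → u ∈ E') :
    ∫⁻ z in E, f z ≤ M * volume E' := by
  set V := ENNReal.ofReal l ^ d with hV
  have hV0 : V ≠ 0 := pow_ne_zero _ (ENNReal.ofReal_pos.mpr hl).ne'
  have hVt : V ≠ ⊤ := ENNReal.pow_ne_top ENNReal.ofReal_ne_top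
  let D : Set (Rd d × Rd d) := {p | p.1 ∈ cube p.2 l}
  have hD : MeasurableSet D := by
    have : D = ⋂ i, {p : Rd d × Rd d | p.2 i ≤ p.1 i} ∩ {p | p.1 i ≤ p.2 i + l} := by
      ext p
      simp [D, cube]
    rw [this]
    refine MeasurableSet.iInter fun i => MeasurableSet.inter ?_ ?_
    · exact measurableSet_le (by fun_prop) (by fun_prop)
    · exact measurableSet_le (by fun_prop) (by fun_prop)
  let F : Rd d → Rd d → ℝ≥0∞ := fun z u => D.indicator (fun p => f p.1) (z, u)
  have hF : AEMeasurable (Function.uncurry F) (volume.prod volume) :=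
    (hf.comp_fst (ν := volume)).indicator hD
  have hinner : ∀ z, ∫⁻ u, F z u = f z * V := by
    intro z
    have hset : {u : Rd d | z ∈ cube u l} = cube (z - WithLp.toLp 2 fun _ => l) l := by
      ext u
      simp only [cube, mem_ofPred_eq, mem_Icc, PiLp.sub_apply]
      refine forall_congr' fun i => ?_
      constructor <;> rintro ⟨h1, h2⟩ <;> constructor <;> linarith
    have h1 : ∀ u, F z u = {u : Rd d | z ∈ cube u l}.indicator (fun _ => f z) u := fun u => rfl
    simp_rw [h1, hset]
    rw [lintegral_indicator_const (isClosed_cube _ _).measurableSet, volume_cube]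
  have houter : ∀ u, ∫⁻ z, F z u = ∫⁻ z in cube u l, f z := by
    intro u
    rw [← lintegral_indicator (isClosed_cube u l).measurableSet]
    rfl
  have key : (∫⁻ z in E, f z) * V ≤ M * volume E' * V := by
    calc (∫⁻ z in E, f z) * V = ∫⁻ z in E, f z * V := by
          rw [lintegral_mul_const' _ _ hVt]
      _ = ∫⁻ z in E, ∫⁻ u, F z u := by simp_rw [hinner]
      _ ≤ ∫⁻ z in E, ∫⁻ u in E', F z u := by
          refine setLIntegral_mono' hE fun z hz => ?_
          rw [← lintegral_indicator hE']
          refine lintegral_mono fun u => ?_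
          by_cases hu : z ∈ cube u l
          · rw [indicator_of_mem (hEE' u z hz hu)]
          · have : F z u = 0 := indicator_of_notMem (s := D) hu _
            rw [this]
            exact zero_le
      _ = ∫⁻ u in E', ∫⁻ z in E, F z u := by
          refine lintegral_lintegral_swap (hF.mono_measure ?_)
          exact Measure.prod_mono Measure.restrict_le_self Measure.restrict_le_self
      _ ≤ ∫⁻ u in E', M * V := by
          refine setLIntegral_mono' hE' fun u hu => ?_
          refine (setLIntegral_le_lintegral _ _).trans ?_
          rw [houter]
          exact hM u hu
      _ = M * volume E' * V := by
          rw [setLIntegral_const]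
          ring
  exact (ENNReal.mul_le_mul_iff_left hV0 hVt).mp key

end MeanOscillation

section Kernel

variable {d : ℕ} {ι : Type} [Fintype ι]

lemma PhiCutoff.le_one {φ : Rd d → ℝ} (hφ : PhiCutoff φ) {x : Rd d} (hx : x ≠ 0) (j : ℤ) :
    φ ((2 : ℝ) ^ (-j) • x) ≤ 1 := by
  have h := hφ.2.2.2.2 x hx
  rw [← h.tsum_eq]
  exact h.summable.le_tsum j fun i _ => hφ.2.1 _

lemma ZetaCutoff.abs_Gam_le_one {ζ : Rd d → ℝ} (hζ : ZetaCutoff ζ) (e : ι → Rd d) (a : ℝ) (ν : ι)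
    (ξ : Rd d) : |Gam ζ e a ν ξ| ≤ 1 := by
  have hnn : ∀ x, 0 ≤ ζ x := hζ.2.1
  have hs : 0 ≤ ∑ ν' : ι, ζ ((2 : ℝ) ^ a • (‖ξ‖⁻¹ • ξ - e ν')) :=
    Finset.sum_nonneg fun _ _ => hnn _
  rw [Gam, abs_of_nonneg (div_nonneg (hnn _) hs)]
  refine div_le_one_of_le₀ ?_ hs
  exact Finset.single_le_sum (f := fun ν' => ζ ((2 : ℝ) ^ a • (‖ξ‖⁻¹ • ξ - e ν')))
    (fun _ _ => hnn _) (Finset.mem_univ ν)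

lemma PhiCutoff.norm_bounds {φ : Rd d → ℝ} (hφ : PhiCutoff φ) {x : Rd d} {j : ℤ}
    (h : φ ((2 : ℝ) ^ (-j) • x) ≠ 0) : (2 : ℝ) ^ j / 2 ≤ ‖x‖ ∧ ‖x‖ ≤ 2 * (2 : ℝ) ^ j := by
  have h1 := hφ.2.2.2.1 (Function.mem_support.mpr h)
  have hpos : (0 : ℝ) < 2 ^ j := by positivity
  simp only [mem_ofPred_eq, norm_smul, zpow_neg, norm_inv, norm_zpow, Real.norm_ofNat] at h1
  obtain ⟨h1, h2⟩ := h1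
  rw [inv_mul_eq_div, le_div_iff₀ hpos] at h1
  rw [inv_mul_eq_div, div_le_iff₀ hpos] at h2
  exact ⟨by linarith, h2⟩

lemma Kjnu_ne_zero_mem_tube {Ω φ ζ : Rd d → ℝ} (hφ : PhiCutoff φ) (hζ : ZetaCutoff ζ)
    {e : ι → Rd d} {a : ℝ} {j : ℤ} {ν : ι} (he : ‖e ν‖ = 1) {x : Rd d}
    (h : Kjnu Ω φ ζ e a j ν x ≠ 0) :
    x ∈ tube (e ν) (2 * (2 : ℝ) ^ j) (2 * (2 : ℝ) ^ j * (2 : ℝ) ^ (-a)) := by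
  rw [Kjnu] at h
  have hφ0 := right_ne_zero_of_mul (left_ne_zero_of_mul h)
  have hG := right_ne_zero_of_mul h
  obtain ⟨hlow, hup⟩ := hφ.norm_bounds hφ0
  have hpos : (0 : ℝ) < 2 ^ j := by positivity
  have hx0 : ‖x‖ ≠ 0 := by linarith
  have hx1 : ‖‖x‖⁻¹ • x‖ = 1 := by
    rw [norm_smul, norm_inv, norm_norm, inv_mul_cancel₀ hx0]
  have hζ0 : ζ ((2 : ℝ) ^ a • (‖x‖⁻¹ • x - e ν)) ≠ 0 := by
    intro h0
    apply hG
    rw [Gam, hx1, inv_one, one_smul, h0, zero_div]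
  have hball := hζ.2.2.2.1 (Function.mem_support.mpr hζ0)
  rw [mem_ball_zero_iff, norm_smul, Real.norm_of_nonneg (by positivity)] at hball
  have hang : ‖‖x‖⁻¹ • x - e ν‖ ≤ (2 : ℝ) ^ (-a) := by
    rw [Real.rpow_neg zero_le_two, ← one_div ((2 : ℝ) ^ a), le_div_iff₀ (by positivity)]
    linarith
  refine ⟨?_, ?_⟩
  · have := abs_real_inner_le_norm x (e ν)
    rw [he, mul_one] at this
    exact this.trans hup
  · refine (norm_sub_inner_smul_le he x ‖x‖).trans ?_
    have hxe : x - ‖x‖ • e ν = ‖x‖ • (‖x‖⁻¹ • x - e ν) := by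
      rw [smul_sub, smul_inv_smul₀ hx0]
    rw [hxe, norm_smul, norm_norm]
    exact mul_le_mul hup hang (norm_nonneg _) (by positivity)

lemma ae_abs_Kjnu_le (hd : 2 ≤ d) {Ω φ ζ : Rd d → ℝ} (hφ : PhiCutoff φ) (hζ : ZetaCutoff ζ)
    (hΩ : ∀ᵐ θ ∂(sphereMeasure d), |Ω θ| ≤ 1) (e : ι → Rd d) (a : ℝ) (j : ℤ) (ν : ι) :
    ∀ᵐ x ∂(volume : Measure (Rd d)), |Kjnu Ω φ ζ e a j ν x| ≤ (2 / (2 : ℝ) ^ j) ^ d := by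
  filter_upwards [ae_normalize_of_ae_sphereMeasure hd hΩ] with x hx
  have hpos : (0 : ℝ) < 2 ^ j := by positivity
  by_cases h : φ ((2 : ℝ) ^ (-j) • x) = 0
  · rw [Kjnu, h]
    simp only [mul_zero, zero_mul, abs_zero]
    positivity
  obtain ⟨hlow, -⟩ := hφ.norm_bounds h
  have hxpos : 0 < ‖x‖ := by linarith
  have hx0 : x ≠ 0 := norm_pos_iff.mp hxpos
  rw [Kjnu, abs_mul, abs_mul, abs_div, abs_of_nonneg (hφ.2.1 _), abs_of_pos (pow_pos hxpos d)]
  have h1 : |Ω (‖x‖⁻¹ • x)| / ‖x‖ ^ d ≤ (2 / (2 : ℝ) ^ j) ^ d := by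
    rw [div_le_iff₀ (pow_pos hxpos d), ← mul_pow]
    refine (hx hx0).trans (one_le_pow₀ ?_)
    rw [div_mul_eq_mul_div, le_div_iff₀ hpos]
    linarith
  calc _ ≤ (2 / (2 : ℝ) ^ j) ^ d * 1 * 1 := by
        refine mul_le_mul (mul_le_mul h1 (hφ.le_one hx0 j) (hφ.2.1 _) (by positivity))
          (hζ.abs_Gam_le_one e a ν _) (abs_nonneg _) (by positivity)
    _ = _ := by ring

lemma ofReal_abs_convK_le {K g : Rd d → ℝ} {A : ℝ}
    (hK : ∀ᵐ x ∂(volume : Measure (Rd d)), |K x| ≤ A) (z : Rd d) :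
    ENNReal.ofReal |convK K g z| ≤ ENNReal.ofReal A * ∫⁻ x, ENNReal.ofReal |g x| := by
  have h1 := (Measure.measurePreserving_sub_left
    (volume : Measure (Rd d)) z).quasiMeasurePreserving.ae hK
  rw [← Real.enorm_eq_ofReal_abs, convK, ← lintegral_const_mul' _ _ ENNReal.ofReal_ne_top]
  refine (enorm_integral_le_lintegral_enorm _).trans (lintegral_mono_ae ?_)
  filter_upwards [h1] with y hy
  rw [enorm_mul, Real.enorm_eq_ofReal_abs, Real.enorm_eq_ofReal_abs]
  gcongr

lemma exists_of_convK_ne_zero {K g : Rd d → ℝ} {z : Rd d} (h : convK K g z ≠ 0) :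
    ∃ y, K (z - y) ≠ 0 ∧ g y ≠ 0 := by
  by_contra! hcon
  refine h (integral_eq_zero_of_ae (Eventually.of_forall fun y => ?_))
  by_cases hy : K (z - y) = 0
  · simp [hy]
  · simp [hcon y hy]

/-- Pointwise domination of a single commutator term by a multiple of the indicator of a tube. -/
lemma ofReal_abs_sub_mul_abs_convK_le (hd : 2 ≤ d) {Ω φ ζ : Rd d → ℝ} (hφ : PhiCutoff φ)
    (hζ : ZetaCutoff ζ) (hΩ : ∀ᵐ θ ∂(sphereMeasure d), |Ω θ| ≤ 1) {e : ι → Rd d} {ν : ι}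
    (he : ‖e ν‖ = 1) {a l : ℝ} {i : ℤ} {c : Rd d} (hl : l ≤ (2 : ℝ) ^ i * (2 : ℝ) ^ (-a))
    (hl' : l ≤ (2 : ℝ) ^ i)
    {g : Rd d → ℝ} (hg : Function.support g ⊆ cube c l)
    (hgl : ∫⁻ x, ENNReal.ofReal |g x| ≤ volume (cube c l)) (k : ℝ) (b : Rd d → ℝ) (z : Rd d)
    (hl0 : 0 ≤ l) :
    ENNReal.ofReal (|b z - k| * |convK (Kjnu Ω φ ζ e a i ν) g z|) ≤
      ENNReal.ofReal ((2 / (2 : ℝ) ^ i) ^ d) * volume (cube c l) *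
        {z | z - c ∈ tube (e ν) ((2 + d) * (2 : ℝ) ^ i)
          ((2 + d) * (2 : ℝ) ^ i * (2 : ℝ) ^ (-a))}.indicator
          (fun z => ENNReal.ofReal |b z - k|) z := by
  by_cases h0 : convK (Kjnu Ω φ ζ e a i ν) g z = 0
  · rw [h0]; simp
  obtain ⟨y, hy, hgy⟩ := exists_of_convK_ne_zero h0
  have h1 := Kjnu_ne_zero_mem_tube hφ hζ he hy
  have h2 := mem_tube_of_norm_le he
    (norm_sub_le_of_mem_cube (hg (Function.mem_support.mpr hgy)) (corner_mem_cube c hl0))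
  have hdn : (0 : ℝ) ≤ d := Nat.cast_nonneg d
  have hmem : z ∈ {z | z - c ∈ tube (e ν) ((2 + d) * (2 : ℝ) ^ i)
      ((2 + d) * (2 : ℝ) ^ i * (2 : ℝ) ^ (-a))} := by
    have h3 := add_mem_tube h1 h2
    rw [sub_add_sub_cancel] at h3
    refine tube_mono ?_ ?_ h3
    · nlinarith [mul_le_mul_of_nonneg_left hl' hdn]
    · nlinarith [mul_le_mul_of_nonneg_left hl hdn]
  rw [indicator_of_mem hmem, ENNReal.ofReal_mul (abs_nonneg _), mul_comm]
  gcongr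
  exact (ofReal_abs_convK_le (ae_abs_Kjnu_le hd hφ hζ hΩ e a i ν) z).trans (by gcongr)

end Kernel

section Summation

variable {d : ℕ}

/-- Integral of the mean oscillation of a `BMO` function over a tube emanating from a cube of
side `2^(i-s)`: only a factor linear in `s` is lost. -/
lemma BMOBound.lintegral_tube_le (hd : 1 ≤ d) {b : Rd d → ℝ} (hb : BMOBound b 1) {e : Rd d}
    (he : ‖e‖ = 1) {L l ρ : ℝ} (hl0 : 0 < l) (hl : l ≤ L * ρ) (hρ0 : 0 ≤ ρ) (hρ : ρ ≤ 1)
    {s : ℕ} (hs : 1 ≤ s) (hLs : L = 2 ^ s * l) (c : Rd d) :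
    ∫⁻ z in {z | z - c ∈ tube e ((2 + d) * L) ((2 + d) * L * ρ)},
        ENNReal.ofReal |b z - cavg b (cube c l)| ≤
      ENNReal.ofReal (s * (1 + (2 * (5 + 4 * d) + 2) * 2 ^ d)) *
        ENNReal.ofReal ((2 * (2 + 2 * d)) ^ d * (L ^ d * ρ ^ (d - 1))) := by
  have hL : 0 < L := by rw [hLs]; positivity
  have hdn : (0 : ℝ) ≤ d := Nat.cast_nonneg d
  have hlL : l ≤ L := hl.trans (by nlinarith)
  have hvol : volume {u | u - c ∈ tube e ((2 + 2 * d) * L) ((2 + 2 * d) * L * ρ)} ≤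
      ENNReal.ofReal ((2 * (2 + 2 * d)) ^ d * (L ^ d * ρ ^ (d - 1))) := by
    refine le_trans (le_of_eq ?_) (volume_tube_scaled_le hd he (by positivity) hL.le hρ0)
    exact (measurePreserving_sub_right volume c).measure_preimage
      (isClosed_tube _ _ _).measurableSet.nullMeasurableSet
  have hcl : ∀ A B, MeasurableSet {z | z - c ∈ tube e A B} := fun A B =>
    ((isClosed_tube e A B).preimage (continuous_sub_right c)).measurableSet
  refine (setLIntegral_le_mul_volume_of_cube (l := l)
    (E' := {u | u - c ∈ tube e ((2 + 2 * d) * L) ((2 + 2 * d) * L * ρ)})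
    (M := ENNReal.ofReal (s * (1 + (2 * (5 + 4 * d) + 2) * 2 ^ d))) ?_ (hcl _ _) (hcl _ _)
    hl0 ?_ ?_).trans (by gcongr)
  · exact ((hb.1.aestronglyMeasurable.aemeasurable.sub_const _).abs).ennreal_ofReal
  · intro u hu
    refine (hb.lintegral_abs_sub_cavg_le hl0 (s + (4 + 4 * d)) fun i => ?_).trans ?_
    · have h1 := norm_le_of_mem_tube he hu
      have h2 := PiLp.norm_apply_le (u - c) i
      rw [PiLp.sub_apply, Real.norm_eq_abs] at h2
      have h3 : ((4 + 4 * d : ℕ) : ℝ) ≤ 2 ^ (4 + 4 * d) := by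
        exact_mod_cast Nat.lt_two_pow_self.le
      push_cast at h3
      calc |u i - c i| ≤ (2 + 2 * d) * L + (2 + 2 * d) * L * ρ := h2.trans h1
        _ ≤ (4 + 4 * d) * L := by
          have : (2 + 2 * d) * L * ρ ≤ (2 + 2 * d) * L := mul_le_of_le_one_right (by positivity) hρ
          linarith
        _ ≤ 2 ^ (4 + 4 * d) * L := mul_le_mul_of_nonneg_right h3 hL.le
        _ = 2 ^ (s + (4 + 4 * d)) * l := by rw [hLs, pow_add]; ring
    · gcongr
      have hs1 : (1 : ℝ) ≤ s := by exact_mod_cast hs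
      have hk : 2 * ((s + (4 + 4 * d) : ℕ) : ℝ) + 2 ≤ s * (2 * (5 + 4 * d) + 2) := by
        push_cast
        nlinarith
      calc 1 + (2 * ((s + (4 + 4 * d) : ℕ) : ℝ) + 2) * 2 ^ d
          ≤ s + s * (2 * (5 + 4 * d) + 2) * 2 ^ d := by gcongr
        _ = _ := by ring
  · intro u z hz hzu
    have h1 : z - u ∈ tube e (d * l) (d * l) :=
      mem_tube_of_norm_le he (norm_sub_le_of_mem_cube hzu (corner_mem_cube u hl0.le))
    have h2 : u - z ∈ tube e (d * l) (d * l) := by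
      refine mem_tube_of_norm_le he ?_
      rw [norm_sub_rev]
      exact norm_sub_le_of_mem_cube hzu (corner_mem_cube u hl0.le)
    have h3 := add_mem_tube h2 hz
    rw [sub_add_sub_cancel] at h3
    refine tube_mono ?_ ?_ h3
    · nlinarith [mul_le_mul_of_nonneg_left hlL hdn]
    · nlinarith [mul_le_mul_of_nonneg_left hl hdn]

lemma countable_isDyadicCube : {Q : Set (Rd d) | IsDyadicCube Q}.Countable := by
  refine (countable_range fun p : ℤ × (Fin d → ℤ) =>
    {x : Rd d | ∀ i, x i ∈ Icc ((2 : ℝ) ^ p.1 * p.2 i) ((2 : ℝ) ^ p.1 * (p.2 i + 1))}).mono ?_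
  rintro Q ⟨k, m, rfl⟩
  exact ⟨(k, m), rfl⟩

lemma exists_le_mul_two_rpow {δ : ℝ} (hδ : 0 < δ) :
    ∃ C : ℝ, 0 < C ∧ ∀ t : ℝ, t ≤ C * (2 : ℝ) ^ (δ * t) := by
  have hlog := Real.log_pos one_lt_two
  refine ⟨(δ * Real.log 2)⁻¹, by positivity, fun t => ?_⟩
  rw [inv_mul_eq_div, le_div_iff₀ (by positivity), Real.rpow_def_of_pos two_pos]
  have := Real.add_one_le_exp (Real.log 2 * (δ * t))
  nlinarith

end Summation

section CubeFamily

variable {d : ℕ}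

/-- The cubes of the family `S` of side `2^(i-s)`, `i ≤ j`, which meet `x + R`. -/
abbrev CubesMeeting (S : Set (Set (Rd d))) (s : ℕ) (j : ℤ) (x : Rd d) (R : Set (Rd d)) : Type :=
  Σ i : {i : ℤ // i ≤ j}, {I : Set (Rd d) // I ∈ S ∧ IsCubeSide I ((2 : ℝ) ^ ((i : ℤ) - (s : ℤ))) ∧
    (I ∩ {y | y - x ∈ R}).Nonempty}

lemma CubesMeeting.ext_cube (hd : 1 ≤ d) {S : Set (Set (Rd d))} {s : ℕ} {j : ℤ} {x : Rd d}
    {R : Set (Rd d)} {p q : CubesMeeting S s j x R} (h : p.2.1 = q.2.1) : p = q := by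
  obtain ⟨⟨i, hi⟩, ⟨I, hI⟩⟩ := p
  obtain ⟨⟨i', hi'⟩, ⟨I', hI'⟩⟩ := q
  obtain rfl : I = I' := h
  obtain ⟨c, hc⟩ := hI.2.1
  obtain ⟨c', hc'⟩ := hI'.2.1
  have h1 : cube c ((2 : ℝ) ^ (i - (s : ℤ))) = cube c' ((2 : ℝ) ^ (i' - (s : ℤ))) :=
    hc.symm.trans hc'
  have h2 := congrArg volume.real h1
  rw [volume_real_cube _ (by positivity), volume_real_cube _ (by positivity)] at h2
  have h3 := (pow_left_inj₀ (by positivity) (by positivity) (by omega)).mp h2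
  have h4 := zpow_right_injective₀ (a := (2 : ℝ)) two_pos (by norm_num) h3
  obtain rfl : i = i' := by simpa using h4
  rfl

lemma two_zpow_sub_le {γ : ℝ} (hγ : γ ≤ 1) (i : ℤ) (s : ℕ) :
    (2 : ℝ) ^ (i - (s : ℤ)) ≤ (2 : ℝ) ^ i * (2 : ℝ) ^ (-((s : ℝ) * γ)) := by
  rw [sub_eq_add_neg, zpow_add₀ two_ne_zero, ← Real.rpow_intCast 2 (-(s : ℤ))]
  refine mul_le_mul_of_nonneg_left ?_ (by positivity)
  refine Real.rpow_le_rpow_of_exponent_le one_le_two ?_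
  push_cast
  nlinarith [mul_nonneg (Nat.cast_nonneg (α := ℝ) s) (sub_nonneg.mpr hγ)]

lemma tsum_volume_cubesMeeting_le (hd : 1 ≤ d) {S : Set (Set (Rd d))}
    (hS : S.Pairwise fun Q Q' => interior Q ∩ interior Q' = ∅) {s : ℕ} {j : ℤ} {γ : ℝ}
    (hγ0 : 0 ≤ γ) (hγ : γ ≤ 1) {e : Rd d} (he : ‖e‖ = 1) (x : Rd d) :
    ∑' p : CubesMeeting S s j x (RR e j ((s : ℝ) * γ)), volume p.2.1 ≤
      ENNReal.ofReal ((2 * (8 + d)) ^ d *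
        (((2 : ℝ) ^ j) ^ d * ((2 : ℝ) ^ (-((s : ℝ) * γ))) ^ (d - 1))) := by
  set ρ : ℝ := (2 : ℝ) ^ (-((s : ℝ) * γ)) with hρ
  have hρ0 : 0 ≤ ρ := by positivity
  have hρ1 : ρ ≤ 1 := Real.rpow_le_one_of_one_le_of_nonpos one_le_two
    (neg_nonpos.mpr (by positivity))
  have hdn : (0 : ℝ) ≤ d := Nat.cast_nonneg d
  have hvol : ∀ p : CubesMeeting S s j x (RR e j ((s : ℝ) * γ)),
      volume p.2.1 = volume (interior p.2.1) := by
    intro p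
    obtain ⟨c, hc⟩ := p.2.2.2.1
    have hc' : p.2.1 = cube c _ := hc
    rw [hc', volume_cube, volume_interior_cube]
  simp_rw [hvol]
  refine (tsum_meas_le_meas_iUnion_of_disjoint volume
    (fun p => isOpen_interior.measurableSet) ?_).trans ?_
  · intro p q hpq
    rw [Function.onFun, disjoint_iff_inter_eq_empty]
    exact hS p.2.2.1 q.2.2.1 fun h => hpq (CubesMeeting.ext_cube hd h)
  · have hsub : (⋃ p : CubesMeeting S s j x (RR e j ((s : ℝ) * γ)), interior p.2.1) ⊆
        (fun y => y - x) ⁻¹' tube e ((8 + d) * (2 : ℝ) ^ j) ((8 + d) * (2 : ℝ) ^ j * ρ) := by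
      refine iUnion_subset fun p q hq => ?_
      have hqI := interior_subset hq
      obtain ⟨w, hwI, hwR⟩ := p.2.2.2.2
      obtain ⟨c, hc⟩ := p.2.2.2.1
      have hc' : p.2.1 = cube c _ := hc
      rw [hc'] at hqI hwI
      obtain ⟨u, hu, v, hv, huv⟩ := hwR
      have hu' : u ∈ tube e ((2 : ℝ) ^ (j + 2)) ((2 : ℝ) ^ (j + 2) * ρ) := hu
      have hv' : v ∈ tube e ((2 : ℝ) ^ (j + 2)) ((2 : ℝ) ^ (j + 2) * ρ) := hv
      have huv' : u + v = w - x := huv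
      have h1 := mem_tube_of_norm_le he (norm_sub_le_of_mem_cube hqI hwI)
      have h2 := add_mem_tube h1 (add_mem_tube hu' hv')
      rw [huv', sub_add_sub_cancel] at h2
      have h4 : (2 : ℝ) ^ (j + 2) = 4 * 2 ^ j := by
        rw [zpow_add₀ two_ne_zero]; norm_num; ring
      have hij : (2 : ℝ) ^ (p.1 : ℤ) ≤ 2 ^ j := zpow_le_zpow_right₀ one_le_two p.1.2
      have hl : (2 : ℝ) ^ ((p.1 : ℤ) - (s : ℤ)) ≤ 2 ^ j * ρ :=
        (two_zpow_sub_le hγ _ s).trans (mul_le_mul_of_nonneg_right hij hρ0)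
      have hl' : (2 : ℝ) ^ ((p.1 : ℤ) - (s : ℤ)) ≤ 2 ^ j :=
        hl.trans (mul_le_of_le_one_right (by positivity) hρ1)
      refine tube_mono ?_ ?_ h2
      · rw [h4]
        nlinarith [mul_le_mul_of_nonneg_left hl' hdn]
      · rw [h4]
        nlinarith [mul_le_mul_of_nonneg_left hl hdn]
    refine (measure_mono hsub).trans ?_
    rw [(measurePreserving_sub_right volume x).measure_preimage
      (isClosed_tube _ _ _).measurableSet.nullMeasurableSet]
    exact volume_tube_scaled_le hd he (by positivity) (by positivity) hρ0

end CubeFamily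

/-- inequality (3.5) in Section 4.
`‖Σ_{i≤j} Σ_{I∈S_{i-s}, I∩(x+R_{jν}^s)≠∅} |b-⟨b⟩_I||T_{iν}^s h_I|‖_{L¹}
  ≤ C_{d,γ,r} 2^{-2γs(d-1)/r} 2^{jd}`. -/
theorem statement10 (d : ℕ) (hd : 2 ≤ d) (γ : ℝ) (hγ0 : 0 < γ) (hγ1 : γ < 1)
    (r : ℝ) (hr : 1 < r)
    (ζ φ : Rd d → ℝ) (hζ : ZetaCutoff ζ) (hφ : PhiCutoff φ) :
    ∃ C : ℝ, 0 < C ∧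
      ∀ (s : ℕ), 100 ≤ s →
      ∀ (ι : Type) [Fintype ι], ∀ (e : ι → Rd d), SphereNet e s γ →
      ∀ (Ω : Rd d → ℝ), Measurable Ω → Homog0 Ω →
        (∀ᵐ θ ∂(sphereMeasure d), |Ω θ| ≤ 1) →
      ∀ (b : Rd d → ℝ), BMOBound b 1 →
      ∀ (S : Set (Set (Rd d))) (h : Set (Rd d) → Rd d → ℝ), GoodFamily S h →
      ∀ (j : ℤ) (ν : ι) (x : Rd d),
        (∫⁻ z, ∑' (i : {i : ℤ // i ≤ j}),
            ∑' (I : {I : Set (Rd d) // I ∈ S ∧ IsCubeSide I ((2:ℝ) ^ ((i:ℤ) - (s:ℤ))) ∧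
                (I ∩ {y | y - x ∈ RR (e ν) j ((s:ℝ) * γ)}).Nonempty}),
              ENNReal.ofReal
                (|b z - cavg b I.1| *
                  |convK (Kjnu Ω φ ζ e ((s:ℝ) * γ) (i:ℤ) ν) (h I.1) z|)) ≤
          ENNReal.ofReal
            (C * (2:ℝ) ^ (-2 * γ * (s:ℝ) * ((d:ℝ) - 1) / r) * (2:ℝ) ^ (j * (d:ℤ))) := by
  have hd1 : 1 ≤ d := by omega
  have hdr : (0 : ℝ) < (d : ℝ) - 1 := by
    have : (2 : ℝ) ≤ d := by exact_mod_cast hd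
    linarith
  have hδ : 0 < 2 * γ * ((d : ℝ) - 1) * (1 - 1 / r) := by
    have : 1 / r < 1 := (div_lt_one (by linarith)).mpr hr
    have : 0 < 1 - 1 / r := by linarith
    positivity
  obtain ⟨C₀, hC₀, hexp⟩ := exists_le_mul_two_rpow hδ
  set C₁ : ℝ := 2 ^ d * (1 + (2 * (5 + 4 * d) + 2) * 2 ^ d) * (2 * (2 + 2 * d)) ^ d *
    (2 * (8 + d)) ^ d with hC₁
  refine ⟨C₁ * C₀, by positivity, ?_⟩
  intro s hs ι _ e he Ω _ _ hΩ b hb S h hSh j ν x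
  have heν := he.1 ν
  set ρ : ℝ := (2 : ℝ) ^ (-((s : ℝ) * γ)) with hρ
  have hρ0 : 0 ≤ ρ := by positivity
  have hρ1 : ρ ≤ 1 := Real.rpow_le_one_of_one_le_of_nonpos one_le_two
    (neg_nonpos.mpr (by positivity))
  have hcount : ∀ i : {i : ℤ // i ≤ j}, Countable {I : Set (Rd d) // I ∈ S ∧
      IsCubeSide I ((2 : ℝ) ^ ((i : ℤ) - (s : ℤ))) ∧
      (I ∩ {y | y - x ∈ RR (e ν) j ((s : ℝ) * γ)}).Nonempty} := fun i =>
    (countable_isDyadicCube.mono fun I hI => hSh.1 I hI.1 :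
      {I : Set (Rd d) | I ∈ S ∧ IsCubeSide I ((2 : ℝ) ^ ((i : ℤ) - (s : ℤ))) ∧
      (I ∩ {y | y - x ∈ RR (e ν) j ((s : ℝ) * γ)}).Nonempty}.Countable).to_subtype
  have hcorner : ∀ p : CubesMeeting S s j x (RR (e ν) j ((s : ℝ) * γ)),
      ∃ c : Rd d, p.2.1 = cube c ((2 : ℝ) ^ ((p.1 : ℤ) - (s : ℤ))) := fun p => p.2.2.2.1
  choose c hc using hcorner
  let E : CubesMeeting S s j x (RR (e ν) j ((s : ℝ) * γ)) → Set (Rd d) := fun p =>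
    {z | z - c p ∈ tube (e ν) ((2 + d) * (2 : ℝ) ^ (p.1 : ℤ)) ((2 + d) * (2 : ℝ) ^ (p.1 : ℤ) * ρ)}
  have hE : ∀ p, MeasurableSet (E p) := fun p =>
    ((isClosed_tube _ _ _).preimage (continuous_sub_right (c p))).measurableSet
  let M : CubesMeeting S s j x (RR (e ν) j ((s : ℝ) * γ)) → ℝ≥0∞ := fun p =>
    ENNReal.ofReal ((2 / (2 : ℝ) ^ (p.1 : ℤ)) ^ d) * volume p.2.1
  let f : CubesMeeting S s j x (RR (e ν) j ((s : ℝ) * γ)) → Rd d → ℝ≥0∞ := fun p z =>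
    M p * (E p).indicator (fun z => ENNReal.ofReal |b z - cavg b p.2.1|) z
  have hfm : ∀ p, AEMeasurable
      ((E p).indicator fun z => ENNReal.ofReal |b z - cavg b p.2.1|) volume := fun p =>
    ((hb.1.aestronglyMeasurable.aemeasurable.sub_const _).abs).ennreal_ofReal.indicator (hE p)
  have hlρ : ∀ i : ℤ, (2 : ℝ) ^ (i - (s : ℤ)) ≤ (2 : ℝ) ^ i * ρ :=
    fun i => two_zpow_sub_le hγ1.le i s
  have hpoint : ∀ p z, ENNReal.ofReal (|b z - cavg b p.2.1| *
      |convK (Kjnu Ω φ ζ e ((s : ℝ) * γ) (p.1 : ℤ) ν) (h p.2.1) z|) ≤ f p z := by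
    intro p z
    obtain ⟨-, hsupp, hnorm⟩ := hSh.2.2 p.2.1 p.2.2.1
    have hnorm' : ∫⁻ x, ENNReal.ofReal |h p.2.1 x| ≤
        volume (cube (c p) ((2 : ℝ) ^ ((p.1 : ℤ) - (s : ℤ)))) := by rwa [← hc p]
    have key := ofReal_abs_sub_mul_abs_convK_le hd hφ hζ hΩ heν (hlρ p.1)
      ((hlρ p.1).trans (mul_le_of_le_one_right (by positivity) hρ1))
      (hsupp.trans (hc p).subset) hnorm' (cavg b p.2.1) b z (by positivity)
    rw [← hc p] at key
    exact key
  have hterm : ∀ p, ∫⁻ z, f p z ≤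
      ENNReal.ofReal (2 ^ d * (s * (1 + (2 * (5 + 4 * d) + 2) * 2 ^ d)) *
        (2 * (2 + 2 * d)) ^ d * ρ ^ (d - 1)) * volume p.2.1 := by
    intro p
    have hL : (0 : ℝ) < (2 : ℝ) ^ (p.1 : ℤ) := by positivity
    have hLs : (2 : ℝ) ^ (p.1 : ℤ) = 2 ^ s * (2 : ℝ) ^ ((p.1 : ℤ) - (s : ℤ)) := by
      rw [zpow_sub₀ two_ne_zero, zpow_natCast]
      field_simp
    have h1 := hb.lintegral_tube_le hd1 heν (by positivity) (hlρ p.1) hρ0 hρ1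
      (by omega : 1 ≤ s) hLs (c p)
    rw [← hc p, ← lintegral_indicator (hE p), ← ENNReal.ofReal_mul (by positivity)] at h1
    rw [lintegral_const_mul'' _ (hfm p)]
    refine (mul_le_mul_right h1 (M p)).trans (le_of_eq ?_)
    simp only [M]
    rw [mul_right_comm, ← ENNReal.ofReal_mul (by positivity)]
    congr 2
    rw [div_pow]
    field_simp
  calc _ ≤ ∫⁻ z, ∑' p : CubesMeeting S s j x (RR (e ν) j ((s : ℝ) * γ)), f p z := by
        refine lintegral_mono fun z => ?_
        rw [ENNReal.tsum_sigma']
        exact ENNReal.tsum_le_tsum fun i => ENNReal.tsum_le_tsum fun I => hpoint ⟨i, I⟩ z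
    _ = ∑' p : CubesMeeting S s j x (RR (e ν) j ((s : ℝ) * γ)), ∫⁻ z, f p z :=
        lintegral_tsum fun p => (hfm p).const_mul _
    _ ≤ ENNReal.ofReal (2 ^ d * (s * (1 + (2 * (5 + 4 * d) + 2) * 2 ^ d)) *
          (2 * (2 + 2 * d)) ^ d * ρ ^ (d - 1)) *
        ∑' p : CubesMeeting S s j x (RR (e ν) j ((s : ℝ) * γ)), volume p.2.1 := by
        rw [← ENNReal.tsum_mul_left]
        exact ENNReal.tsum_le_tsum hterm
    _ ≤ ENNReal.ofReal (2 ^ d * (s * (1 + (2 * (5 + 4 * d) + 2) * 2 ^ d)) *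
          (2 * (2 + 2 * d)) ^ d * ρ ^ (d - 1)) *
        ENNReal.ofReal ((2 * (8 + d)) ^ d * (((2 : ℝ) ^ j) ^ d * ρ ^ (d - 1))) := by
        gcongr
        exact tsum_volume_cubesMeeting_le hd1 hSh.2.1 hγ0.le hγ1.le heν x
    _ ≤ _ := by
        rw [← ENNReal.ofReal_mul (by positivity)]
        refine ENNReal.ofReal_le_ofReal ?_
        have hρ2 : ρ ^ (d - 1) * ρ ^ (d - 1) = (2 : ℝ) ^ (-2 * γ * s * ((d : ℝ) - 1)) := by
          rw [← mul_pow, hρ, ← Real.rpow_add two_pos, ← Real.rpow_natCast,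
            ← Real.rpow_mul zero_le_two, Nat.cast_sub hd1]
          congr 1
          push_cast
          ring
        have hsplit : (2 : ℝ) ^ (2 * γ * ((d : ℝ) - 1) * (1 - 1 / r) * s) *
            (2 : ℝ) ^ (-2 * γ * s * ((d : ℝ) - 1)) =
            (2 : ℝ) ^ (-2 * γ * s * ((d : ℝ) - 1) / r) := by
          rw [← Real.rpow_add two_pos]
          congr 1
          ring
        have hj : ((2 : ℝ) ^ j) ^ d = (2 : ℝ) ^ (j * (d : ℤ)) := by
          rw [zpow_mul, zpow_natCast]
        calc _ = C₁ * (s * (ρ ^ (d - 1) * ρ ^ (d - 1))) * ((2 : ℝ) ^ j) ^ d := by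
              rw [hC₁]; ring
          _ ≤ C₁ * (C₀ * (2 : ℝ) ^ (2 * γ * ((d : ℝ) - 1) * (1 - 1 / r) * s) *
              (ρ ^ (d - 1) * ρ ^ (d - 1))) * ((2 : ℝ) ^ j) ^ d := by
              gcongr
              exact hexp s
          _ = _ := by
              rw [hρ2, mul_assoc C₀, hsplit, hj]
              ring
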